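/- arXiv:0803.2262 — 2 statements merged into one kernel-verified Lean document; each statement's English description precedes it below -/
import Mathlib

section
/- Let q be a prime power and let 𝒞 be a set of m×n matrices over GF(q), all of rank r, containing at least two elements, with minimum rank distance d_R. Then for any two distinct X, Y ∈ 𝒞 one has d_I(R(X),R(Y)) ≥ d_R − r and d_I(C(X),C(Y)) ≥ d_R − r; in particular, whenever R(𝒞) (respectively C(𝒞)) contains at least two subspaces, its minimum injection distance is at least d_R − r. -/
open Module

noncomputable def injDist {F V : Type*} [Field F] [AddCommGroup V] [Module F V]
    (U W : Submodule F V) : ℕ :=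
  finrank F ↥(U ⊔ W) - min (finrank F ↥U) (finrank F ↥W)

def rowSpace {F : Type*} [CommRing F] {m n : ℕ} (X : Matrix (Fin m) (Fin n) F) :
    Submodule F (Fin n → F) :=
  LinearMap.range X.vecMulLinear

def colSpace {F : Type*} [CommRing F] {m n : ℕ} (X : Matrix (Fin m) (Fin n) F) :
    Submodule F (Fin m → F) :=
  LinearMap.range X.mulVecLin

noncomputable def minRankDist {F : Type*} [Field F] {m n : ℕ}
    (C : Set (Matrix (Fin m) (Fin n) F)) : ℕ :=
  sInf {e | ∃ X ∈ C, ∃ Y ∈ C, X ≠ Y ∧ (X - Y).rank = e}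

noncomputable def minInjDist {F V : Type*} [Field F] [AddCommGroup V] [Module F V]
    (S : Set (Submodule F V)) : ℕ :=
  sInf {e | ∃ U ∈ S, ∃ W ∈ S, U ≠ W ∧ injDist U W = e}

/-- Maximum cardinality of a nonempty code of `m × n` matrices whose ranks all lie in `I`
and in which any two distinct codewords are at rank distance at least `d`. -/
noncomputable def maxRankCode (F : Type*) [Field F] [Fintype F] (m n d : ℕ) (I : Set ℕ) : ℕ :=
  sSup {c : ℕ | ∃ C : Set (Matrix (Fin m) (Fin n) F), C.Nonempty ∧
    (∀ X ∈ C, X.rank ∈ I) ∧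
    (∀ X ∈ C, ∀ Y ∈ C, X ≠ Y → d ≤ (X - Y).rank) ∧ C.ncard = c}

/-- `A_R(q,m,n,d,r)` : maximum cardinality of a constant-rank code of constant rank `r`
and minimum rank distance at least `d` in `GF(q)^{m × n}`. -/
noncomputable def A_R (F : Type*) [Field F] [Fintype F] (m n d r : ℕ) : ℕ :=
  maxRankCode F m n d {r}

/-- `A_C(q,n,r,d)` : maximum cardinality of a constant-dimension code of dimension `r`
and minimum injection distance at least `d` in `GF(q)^n`. -/
noncomputable def A_C (F : Type*) [Field F] [Fintype F] (n r d : ℕ) : ℕ :=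
  sSup {c : ℕ | ∃ S : Set (Submodule F (Fin n → F)), S.Nonempty ∧
    (∀ U ∈ S, finrank F ↥U = r) ∧
    (∀ U ∈ S, ∀ V ∈ S, U ≠ V → d ≤ injDist U V) ∧ S.ncard = c}

/-- `N_R(q,m,n,r)` : number of `m × n` matrices over `GF(q)` of rank `r`. -/
noncomputable def N_R (F : Type*) [Field F] [Fintype F] (m n r : ℕ) : ℕ :=
  Nat.card {X : Matrix (Fin m) (Fin n) F // X.rank = r}

/-- `α(m,s) = ∏_{i=0}^{s-1} (q^m - q^i)`. -/
def alphaq (q m s : ℕ) : ℕ := ∏ i ∈ Finset.range s, (q ^ m - q ^ i)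

/-- The Gaussian binomial `[n r]_q = α(n,r) / α(r,r)`. -/
def gaussBinom (q n r : ℕ) : ℕ := alphaq q n r / alphaq q r r

/-- `K_q = ∏_{j=1}^∞ (1 - q^{-j})`. -/
noncomputable def Kq (q : ℕ) : ℝ := ∏' j : ℕ, (1 - ((q : ℝ))⁻¹ ^ (j + 1))

/-- `M(q,m,n,d,r)` : the number of codewords of rank `r` in an `(n, n-d+1, d)` linear MRD
code over `GF(q^m)`. -/
def Mcount (q m n d r : ℕ) : ℤ :=
  (gaussBinom q n r : ℤ) *
    ∑ j ∈ Finset.Icc d r, (-1 : ℤ) ^ (r - j) * (gaussBinom q r j : ℤ) *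
      (q : ℤ) ^ ((r - j) * (r - j - 1) / 2) * ((q : ℤ) ^ (m * (j - d + 1)) - 1)

theorem rank_eq_finrank_rowSpace {F : Type*} [Field F] {m n : ℕ}
    (X : Matrix (Fin m) (Fin n) F) : finrank F ↥(rowSpace X) = X.rank := by
  rw [← Matrix.rank_transpose, Matrix.rank, Matrix.mulVecLin_transpose]
  rfl

theorem finrank_sup_row {F : Type*} [Field F] {m n : ℕ}
    (X Y : Matrix (Fin m) (Fin n) F) :
    (X - Y).rank ≤ finrank F ↥(rowSpace X ⊔ rowSpace Y) := by
  rw [← rank_eq_finrank_rowSpace]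
  apply Submodule.finrank_mono
  rintro _ ⟨v, rfl⟩
  have h : (X - Y).vecMulLinear v = X.vecMulLinear v - Y.vecMulLinear v := by
    simp [Matrix.vecMul_sub]
  rw [h]
  exact Submodule.sub_mem _ (Submodule.mem_sup_left ⟨v, rfl⟩) (Submodule.mem_sup_right ⟨v, rfl⟩)

theorem finrank_sup_col {F : Type*} [Field F] {m n : ℕ}
    (X Y : Matrix (Fin m) (Fin n) F) :
    (X - Y).rank ≤ finrank F ↥(colSpace X ⊔ colSpace Y) := by
  apply Submodule.finrank_mono
  rintro _ ⟨v, rfl⟩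
  have h : (X - Y).mulVecLin v = X.mulVecLin v - Y.mulVecLin v := by
    simp [Matrix.sub_mulVec]
  rw [h]
  exact Submodule.sub_mem _ (Submodule.mem_sup_left ⟨v, rfl⟩) (Submodule.mem_sup_right ⟨v, rfl⟩)

theorem stmt1 {q m n r dR : ℕ} (F : Type*) [Field F] [Fintype F] (hF : Fintype.card F = q)
    (C : Set (Matrix (Fin m) (Fin n) F))
    (htwo : ∃ X ∈ C, ∃ Y ∈ C, X ≠ Y)
    (hrk : ∀ X ∈ C, X.rank = r)
    (hdR : minRankDist C = dR) :
    (∀ X ∈ C, ∀ Y ∈ C, X ≠ Y →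
        dR - r ≤ injDist (rowSpace X) (rowSpace Y) ∧
        dR - r ≤ injDist (colSpace X) (colSpace Y)) ∧
      ((∃ U ∈ rowSpace '' C, ∃ V ∈ rowSpace '' C, U ≠ V) →
        dR - r ≤ minInjDist (rowSpace '' C)) ∧
      ((∃ U ∈ colSpace '' C, ∃ V ∈ colSpace '' C, U ≠ V) →
        dR - r ≤ minInjDist (colSpace '' C)) := by
  have key : ∀ X ∈ C, ∀ Y ∈ C, X ≠ Y →
        dR - r ≤ injDist (rowSpace X) (rowSpace Y) ∧
        dR - r ≤ injDist (colSpace X) (colSpace Y) := by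
    intro X hX Y hY hne
    have hd : dR ≤ (X - Y).rank := by
      rw [← hdR]
      exact Nat.sInf_le ⟨X, hX, Y, hY, hne, rfl⟩
    have h1 := finrank_sup_row X Y
    have h2 := finrank_sup_col X Y
    have hcX : finrank F ↥(colSpace X) = r := hrk X hX
    have hcY : finrank F ↥(colSpace Y) = r := hrk Y hY
    unfold injDist
    rw [rank_eq_finrank_rowSpace, rank_eq_finrank_rowSpace, hcX, hcY, hrk X hX, hrk Y hY, min_self]
    omega
  refine ⟨key, ?_, ?_⟩
  · rintro ⟨U, hU, V, hV, hUV⟩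
    unfold minInjDist
    refine le_csInf ⟨_, U, hU, V, hV, hUV, rfl⟩ ?_
    rintro _ ⟨_, ⟨X, hX, rfl⟩, _, ⟨Y, hY, rfl⟩, hne, rfl⟩
    exact (key X hX Y hY (fun h => hne (by rw [h]))).1
  · rintro ⟨U, hU, V, hV, hUV⟩
    unfold minInjDist
    refine le_csInf ⟨_, U, hU, V, hV, hUV, rfl⟩ ?_
    rintro _ ⟨_, ⟨X, hX, rfl⟩, _, ⟨Y, hY, rfl⟩, hne, rfl⟩
    exact (key X hX Y hY (fun h => hne (by rw [h]))).2
end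

section
/- (Hamming-type bound) Let q be a prime power, 1 ≤ r, d ≤ n ≤ m, and set t = ⌊(d−1)/2⌋. Then for every s with 1 ≤ s ≤ n and every fixed m×n matrix Y over GF(q) of rank r: A_R(q,m,n,d,r) · |{Z ∈ GF(q)^{m×n} : rank(Z) = s and rank(Z − Y) ≤ t}| ≤ N_R(q,m,n,s). -/
open Module

theorem equiv_of_finrank_range_eq {F V W : Type*} [Field F] [AddCommGroup V] [Module F V]
    [AddCommGroup W] [Module F W] [FiniteDimensional F V] [FiniteDimensional F W]
    (f g : V →ₗ[F] W)
    (h : finrank F (LinearMap.range f) = finrank F (LinearMap.range g)) :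
    ∃ (e : V ≃ₗ[F] V) (e' : W ≃ₗ[F] W), ∀ x, e' (f (e x)) = g x := by
  obtain ⟨C, hC'⟩ := Submodule.exists_isCompl (LinearMap.ker f)
  obtain ⟨D, hD'⟩ := Submodule.exists_isCompl (LinearMap.ker g)
  have hC := hC'.symm
  have hD := hD'.symm
  have hk : finrank F (LinearMap.ker g) = finrank F (LinearMap.ker f) := by
    have h1 := f.finrank_range_add_finrank_ker
    have h2 := g.finrank_range_add_finrank_ker
    omega
  let a : LinearMap.ker g ≃ₗ[F] LinearMap.ker f := LinearEquiv.ofFinrankEq _ _ hk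
  let φ : LinearMap.range g ≃ₗ[F] LinearMap.range f := LinearEquiv.ofFinrankEq _ _ h.symm
  let kf := LinearMap.kerComplementEquivRange f hC
  let kg := LinearMap.kerComplementEquivRange g hD
  let c : D ≃ₗ[F] C := kg ≪≫ₗ φ ≪≫ₗ kf.symm
  obtain ⟨e', he'⟩ := Submodule.exists_linearEquiv_restrict_eq φ.symm
  let e : V ≃ₗ[F] V := (D.prodEquivOfIsCompl _ hD).symm ≪≫ₗ (LinearEquiv.prodCongr c a) ≪≫ₗ
    (C.prodEquivOfIsCompl _ hC)
  refine ⟨e, e', fun x => ?_⟩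
  obtain ⟨⟨u, k⟩, rfl⟩ := (D.prodEquivOfIsCompl _ hD).surjective x
  have hkf : ∀ y : C, ((kf y : LinearMap.range f) : W) = f y := fun y => rfl
  have hkg : ∀ y : D, ((kg y : LinearMap.range g) : W) = g y := fun y => rfl
  have h1 : e (D.prodEquivOfIsCompl _ hD (u, k)) = (c u : V) + (a k : V) := by
    simp [e]
  have h2 : f (a k) = 0 := (a k).2
  have h3 : g k = 0 := k.2
  have h4 : f (c u) = (φ (kg u) : W) := by
    rw [← hkf]
    simp [c]
  rw [h1, map_add, h2, add_zero, h4, ← he', LinearEquiv.symm_apply_apply, hkg]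
  simp [h3]

theorem matrix_equiv_of_rank_eq {F : Type*} [Field F] {m n : ℕ}
    (X Y : Matrix (Fin m) (Fin n) F) (h : Y.rank = X.rank) :
    ∃ T : Matrix (Fin m) (Fin n) F ≃ₗ[F] Matrix (Fin m) (Fin n) F,
      (∀ Z, (T Z).rank = Z.rank) ∧ T Y = X := by
  obtain ⟨e, e', he⟩ := equiv_of_finrank_range_eq Y.mulVecLin X.mulVecLin h
  let T : Matrix (Fin m) (Fin n) F ≃ₗ[F] Matrix (Fin m) (Fin n) F :=
    Matrix.toLin' ≪≫ₗ (LinearEquiv.arrowCongr e.symm e') ≪≫ₗ Matrix.toLin'.symm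
  have hT : ∀ Z, (T Z).mulVecLin = (e'.toLinearMap ∘ₗ Z.mulVecLin) ∘ₗ e.toLinearMap := by
    intro Z
    rw [← Matrix.toLin'_apply', ← Matrix.toLin'_apply']
    ext x
    simp [T, LinearEquiv.arrowCongr_apply]
  refine ⟨T, fun Z => ?_, ?_⟩
  · unfold Matrix.rank
    rw [hT, LinearMap.range_comp_of_range_eq_top _ e.range, LinearMap.range_comp]
    exact LinearEquiv.finrank_map_eq e' _
  · apply Matrix.toLin'.injective
    rw [Matrix.toLin'_apply', Matrix.toLin'_apply', hT]
    exact LinearMap.ext he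

theorem matrix_rank_add_le {F : Type*} [Field F] {m n : ℕ}
    (X Y : Matrix (Fin m) (Fin n) F) : (X + Y).rank ≤ X.rank + Y.rank := by
  unfold Matrix.rank
  rw [Matrix.mulVecLin_add]
  exact (Submodule.finrank_mono (LinearMap.range_add_le _ _)).trans
    (Submodule.finrank_add_le_finrank_add_finrank _ _)

theorem matrix_rank_sub_comm {F : Type*} [Field F] {m n : ℕ}
    (X Y : Matrix (Fin m) (Fin n) F) : (X - Y).rank = (Y - X).rank := by
  have h : (X - Y).mulVecLin = -(Y - X).mulVecLin := by
    ext; simp [Matrix.sub_mulVec]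
  unfold Matrix.rank
  rw [h, LinearMap.range_neg]

theorem stmt8 {q m n d r s : ℕ} (F : Type*) [Field F] [Fintype F] (hF : Fintype.card F = q)
    (hr1 : 1 ≤ r) (hd1 : 1 ≤ d) (hrn : r ≤ n) (hdn : d ≤ n) (hnm : n ≤ m)
    (hs1 : 1 ≤ s) (hsn : s ≤ n)
    (Y : Matrix (Fin m) (Fin n) F) (hY : Y.rank = r) :
    A_R F m n d r *
        Nat.card {Z : Matrix (Fin m) (Fin n) F // Z.rank = s ∧ (Z - Y).rank ≤ (d - 1) / 2}
      ≤ N_R F m n s := by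
  classical
  unfold A_R maxRankCode N_R
  set S : Set ℕ := {c : ℕ | ∃ C : Set (Matrix (Fin m) (Fin n) F), C.Nonempty ∧
    (∀ X ∈ C, X.rank ∈ ({r} : Set ℕ)) ∧
    (∀ X ∈ C, ∀ Y ∈ C, X ≠ Y → d ≤ (X - Y).rank) ∧ C.ncard = c} with hS
  have hne : S.Nonempty := by
    refine ⟨1, {Y}, Set.singleton_nonempty _, ?_, ?_, Set.ncard_singleton _⟩
    · rintro X rfl
      exact hY
    · rintro X rfl Z rfl hXZ
      exact absurd rfl hXZ
  have hbdd : BddAbove S := by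
    refine ⟨Nat.card (Matrix (Fin m) (Fin n) F), ?_⟩
    rintro c ⟨C, -, -, -, rfl⟩
    exact Set.ncard_le_card C
  obtain ⟨C, -, hCr, hCd, hCc⟩ := Nat.sSup_mem hne hbdd
  rw [← hCc, ← Nat.card_coe_set_eq, ← Nat.card_prod]
  have hT : ∀ X : C, ∃ T : Matrix (Fin m) (Fin n) F ≃ₗ[F] Matrix (Fin m) (Fin n) F,
      (∀ Z, (T Z).rank = Z.rank) ∧ T Y = X := fun X =>
    matrix_equiv_of_rank_eq _ _ (hY.trans (hCr X X.2).symm)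
  choose T hTr hTY using hT
  refine Nat.card_le_card_of_injective
    (fun p : C × {Z : Matrix (Fin m) (Fin n) F // Z.rank = s ∧ (Z - Y).rank ≤ (d - 1) / 2} =>
      (⟨T p.1 p.2.1, (hTr _ _).trans p.2.2.1⟩ :
        {X : Matrix (Fin m) (Fin n) F // X.rank = s})) ?_
  rintro ⟨X, Z, hZ⟩ ⟨X', Z', hZ'⟩ heq
  have heq' : T X Z = T X' Z' := congrArg Subtype.val heq
  have b1 : (T X Z - X).rank ≤ (d - 1) / 2 := by
    have := hTr X (Z - Y)
    rw [map_sub, hTY] at this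
    exact this.le.trans hZ.2
  have b2 : (T X' Z' - X').rank ≤ (d - 1) / 2 := by
    have := hTr X' (Z' - Y)
    rw [map_sub, hTY] at this
    exact this.le.trans hZ'.2
  have hX : X = X' := by
    by_contra hXX
    have h1 := hCd X X.2 X' X'.2 (fun h => hXX (Subtype.ext h))
    rw [← heq'] at b2
    have h3 : (X : Matrix (Fin m) (Fin n) F) - T X Z + (T X Z - X') = X - X' := by abel
    have h4 := matrix_rank_add_le ((X : Matrix (Fin m) (Fin n) F) - T X Z) (T X Z - X')
    rw [h3, matrix_rank_sub_comm (X : Matrix (Fin m) (Fin n) F) (T X Z)] at h4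
    omega
  subst hX
  have hZZ : Z = Z' := (T X).injective heq'
  subst hZZ
  rfl
end
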